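/- Let U ⊆ ℝⁿ be open and let X₁,…,X_k : U → ℝⁿ be smooth vector fields that are bracket generating and pointwise linearly independent on U. Let f : U → ℝ be a function such that for each i = 1,…,k the horizontal derivative Xᵢf — defined at x as the derivative at t = 0 of t ↦ f(αₓ(t)) along the integral curve αₓ of Xᵢ with αₓ(0) = x — exists at every point of U and is continuous on U. Then for every point x₀ ∈ U there exist a neighbourhood U' ⊆ U of x₀ and a constant C such that |f(x) − f(x₀)| ≤ C·d(x, x₀) for all x ∈ U', where d is the subriemannian distance. -/

import Mathlib

noncomputable section
open MeasureTheory

/-- The Lie bracket of two vector fields on `ℝⁿ`. -/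
def lieB {n : ℕ} (X Y : (Fin n → ℝ) → (Fin n → ℝ)) : (Fin n → ℝ) → (Fin n → ℝ) :=
  fun x => fderiv ℝ Y x (X x) - fderiv ℝ X x (Y x)

/-- The smallest set of vector fields containing `V` and closed under Lie brackets. -/
inductive LieHull {n : ℕ} (V : Set ((Fin n → ℝ) → (Fin n → ℝ))) :
    ((Fin n → ℝ) → (Fin n → ℝ)) → Prop
  | base {X} : X ∈ V → LieHull V X
  | br {X Y} : LieHull V X → LieHull V Y → LieHull V (lieB X Y)

/-- The family `V` is bracket generating on `U`. -/
def BracketGenerating {n : ℕ} (U : Set (Fin n → ℝ))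
    (V : Set ((Fin n → ℝ) → (Fin n → ℝ))) : Prop :=
  ∀ x ∈ U, Submodule.span ℝ {v | ∃ Z, LieHull V Z ∧ v = Z x} = ⊤

/-- `γ` is a curve in `U` on `[a,b]` controlled by the vector fields `X` with
integrable controls `u`, expressed in integral form. -/
def IsControlledOn {n k : ℕ} (U : Set (Fin n → ℝ)) (X : Fin k → (Fin n → ℝ) → (Fin n → ℝ))
    (γ : ℝ → Fin n → ℝ) (a b : ℝ) (u : Fin k → ℝ → ℝ) : Prop :=
  a ≤ b ∧ (∀ t ∈ Set.Icc a b, γ t ∈ U) ∧ ContinuousOn γ (Set.Icc a b) ∧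
    (∀ i, IntegrableOn (u i) (Set.Icc a b)) ∧
    IntegrableOn (fun s => ∑ i, u i s • X i (γ s)) (Set.Icc a b) ∧
    ∀ t ∈ Set.Icc a b, γ t = γ a + ∫ s in a..t, ∑ i, u i s • X i (γ s)

/-- The subriemannian length of a controlled piece, for the metric making
`X₁, …, X_k` orthonormal. -/
def srLength {k : ℕ} (u : Fin k → ℝ → ℝ) (a b : ℝ) : ℝ :=
  ∫ s in a..b, Real.sqrt (∑ i, (u i s) ^ 2)

/-- The set of lengths of horizontal curves in `U` joining `x` to `y`. -/
def HorizontalLengths {n k : ℕ} (U : Set (Fin n → ℝ))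
    (X : Fin k → (Fin n → ℝ) → (Fin n → ℝ)) (x y : Fin n → ℝ) : Set ℝ :=
  { ℓ | ∃ (N : ℕ) (t : Fin (N + 1) → ℝ) (γ : ℝ → Fin n → ℝ) (u : Fin N → Fin k → ℝ → ℝ),
      Monotone t ∧ γ (t 0) = x ∧ γ (t (Fin.last N)) = y ∧
      (∀ j : Fin N, IsControlledOn U X γ (t j.castSucc) (t j.succ) (u j)) ∧
      ℓ = ∑ j : Fin N, srLength (u j) (t j.castSucc) (t j.succ) }

/-- The subriemannian (Carnot–Carathéodory) distance on `U`. -/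
def srDist {n k : ℕ} (U : Set (Fin n → ℝ)) (X : Fin k → (Fin n → ℝ) → (Fin n → ℝ))
    (x y : Fin n → ℝ) : ENNReal :=
  sInf (ENNReal.ofReal '' HorizontalLengths U X x y)


section HelperMaterial
open Set Filter Topology MeasureTheory


section Nem
variable {K : Type} [TopologicalSpace K] [CompactSpace K]

/-- pointwise application as a continuous bilinear map on spaces of continuous maps -/
noncomputable def ptApply (K : Type) [TopologicalSpace K] [CompactSpace K]
    (E F : Type) [NormedAddCommGroup E] [NormedSpace ℝ E]
    [NormedAddCommGroup F] [NormedSpace ℝ F] :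
    C(K, E →L[ℝ] F) →L[ℝ] C(K, E) →L[ℝ] C(K, F) :=
  LinearMap.mkContinuous₂
    (LinearMap.mk₂ ℝ (fun (A : C(K, E →L[ℝ] F)) (h : C(K, E)) => (⟨fun s => A s (h s), by fun_prop⟩ : C(K, F)))
      (by intros; ext; simp) (by intros; ext; simp) (by intros; ext; simp) (by intros; ext; simp))
    1 (by
      intro A h
      rw [ContinuousMap.norm_le _ (by positivity)]
      intro s
      simp only [LinearMap.mk₂_apply, ContinuousMap.coe_mk, one_mul]
      exact (A s).le_of_opNorm_le_of_le (A.norm_coe_le_norm s) (h.norm_coe_le_norm s))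

lemma ptApply_apply {E F : Type} [NormedAddCommGroup E] [NormedSpace ℝ E]
    [NormedAddCommGroup F] [NormedSpace ℝ F] (A : C(K, E →L[ℝ] F)) (h : C(K, E)) (s : K) :
    ptApply K E F A h s = A s (h s) := rfl

variable {E : Type} [NormedAddCommGroup E] [NormedSpace ℝ E]

lemma nem_hasFDerivAt {F : Type} [NormedAddCommGroup F] [NormedSpace ℝ F]
    (X : C(E, F)) (DX : C(E, E →L[ℝ] F)) (hX : ∀ x, HasFDerivAt X (DX x) x) (γ : C(K, E)) :
    HasFDerivAt (fun γ : C(K, E) => X.comp γ) (ptApply K E F (DX.comp γ)) γ := by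
  rw [hasFDerivAt_iff_isLittleO_nhds_zero, Asymptotics.isLittleO_iff]
  intro ε hε
  have hc : Continuous (fun γ : C(K, E) => DX.comp γ) := ContinuousMap.continuous_postcomp DX
  have hc' : ∀ᶠ γ' in 𝓝 γ, dist (DX.comp γ') (DX.comp γ) < ε :=
    (hc.tendsto γ).eventually (Metric.ball_mem_nhds (DX.comp γ) hε)
  obtain ⟨δ, hδ, hδ'⟩ := Metric.eventually_nhds_iff.1 hc'
  filter_upwards [Metric.ball_mem_nhds (0 : C(K, E)) hδ] with h hh
  rw [mem_ball_zero_iff] at hh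
  rw [ContinuousMap.norm_le _ (by positivity)]
  intro s
  simp only [ContinuousMap.sub_apply, ContinuousMap.comp_apply, ContinuousMap.add_apply,
    ptApply_apply]
  have key : ∀ z ∈ Metric.ball (γ s) δ, ‖DX z - DX (γ s)‖ ≤ ε := by
    intro z hz
    have h1 := hδ' (y := γ + ContinuousMap.const K (z - γ s)) (by
      rw [dist_eq_norm, add_sub_cancel_left]
      refine lt_of_le_of_lt ((ContinuousMap.norm_le _ (norm_nonneg (z - γ s))).2 ?_) 
        (by simpa [dist_eq_norm] using hz)
      intro x; simp)
    have h2 := ContinuousMap.norm_coe_le_norm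
      (DX.comp (γ + ContinuousMap.const K (z - γ s)) - DX.comp γ) s
    rw [← dist_eq_norm] at h2
    have := h2.trans h1.le
    simpa using this
  have hhs : ‖h s‖ < δ := (h.norm_coe_le_norm s).trans_lt hh
  have := (convex_ball (γ s) δ).norm_image_sub_le_of_norm_hasFDerivWithin_le' (𝕜 := ℝ)
    (f := X) (f' := fun z => DX z) (φ := DX (γ s)) (x := γ s) (y := γ s + h s) (C := ε)
    (fun x _ => (hX x).hasFDerivWithinAt) key (Metric.mem_ball_self hδ) (by simpa using hhs)
  rw [add_sub_cancel_left] at this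
  exact this.trans (by gcongr; exact h.norm_coe_le_norm s)

lemma nem_contDiff (m : ℕ) : ∀ {F : Type} [NormedAddCommGroup F] [NormedSpace ℝ F]
    (X : C(E, F)) (_ : ContDiff ℝ m X),
    ContDiff ℝ m (fun γ : C(K, E) => X.comp γ) := by
  induction m with
  | zero =>
    intro F _ _ X hX
    exact contDiff_zero.2 (ContinuousMap.continuous_postcomp X)
  | succ m ih =>
    intro F _ _ X hX
    have hX' := hX
    push_cast at hX ⊢
    rw [contDiff_succ_iff_fderiv] at hX
    let DX : C(E, E →L[ℝ] F) := ⟨fderiv ℝ X, hX.2.2.continuous⟩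
    have hd := fun γ : C(K, E) => nem_hasFDerivAt X DX (fun x => (hX.1 x).hasFDerivAt) γ
    rw [contDiff_succ_iff_fderiv]
    refine ⟨fun γ => (hd γ).differentiableAt, by simp, ?_⟩
    have : fderiv ℝ (fun γ : C(K, E) => X.comp γ) = fun γ => ptApply K E F (DX.comp γ) :=
      funext fun γ => (hd γ).fderiv
    rw [this]
    exact (ptApply K E F).contDiff.comp (ih DX hX.2.2)

end Nem

section Flow
variable {E : Type} [NormedAddCommGroup E] [NormedSpace ℝ E]

local notation "KK" => (Icc (-2 : ℝ) 2)

/-- Volterra operator -/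
noncomputable def volt (E : Type) [NormedAddCommGroup E] [NormedSpace ℝ E]  :
    C(KK, E) →L[ℝ] C(KK, E) :=
  LinearMap.mkContinuous
    { toFun := fun h => ⟨fun s => ∫ r in (0:ℝ)..s, IccExtend (by norm_num) h r, by
        have : Continuous (IccExtend (by norm_num : (-2:ℝ) ≤ 2) h) := h.continuous.Icc_extend'
        exact (intervalIntegral.continuous_primitive
          (fun a b => this.intervalIntegrable a b) 0).comp continuous_subtype_val⟩
      map_add' := by
        intro f g
        ext s
        have hf : Continuous (IccExtend (by norm_num : (-2:ℝ) ≤ 2) f) := f.continuous.Icc_extend'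
        have hg : Continuous (IccExtend (by norm_num : (-2:ℝ) ≤ 2) g) := g.continuous.Icc_extend'
        exact intervalIntegral.integral_add (hf.intervalIntegrable _ _) (hg.intervalIntegrable _ _)
      map_smul' := by
        intro c f
        ext s
        exact intervalIntegral.integral_smul c _ } 2 (by
    intro h
    rw [ContinuousMap.norm_le _ (by positivity)]
    intro s
    have := intervalIntegral.norm_integral_le_of_norm_le_const (a := 0) (b := s)
      (f := IccExtend (by norm_num : (-2:ℝ) ≤ 2) h) (C := ‖h‖) (fun x _ => h.norm_coe_le_norm _)
    refine this.trans ?_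
    rw [mul_comm]
    gcongr
    rw [sub_zero, abs_le]; exact s.2)

lemma volt_apply (h : C(KK, E)) (s : KK) :
    volt E h s = ∫ r in (0:ℝ)..s, IccExtend (by norm_num) h r := rfl

noncomputable def cst (E : Type) [NormedAddCommGroup E] [NormedSpace ℝ E] : E →L[ℝ] C(KK, E) :=
  LinearMap.mkContinuous
    { toFun := fun x => ContinuousMap.const _ x
      map_add' := by intros; rfl
      map_smul' := by intros; rfl } 1 (by
    intro h
    rw [ContinuousMap.norm_le _ (by positivity)]
    intro s
    rw [one_mul]
    exact le_rfl)

lemma cst_apply (x : E) (s : KK) : cst E x s = x := rfl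

noncomputable def evl (E : Type) [NormedAddCommGroup E] [NormedSpace ℝ E] (s : KK) :
    C(KK, E) →L[ℝ] E := ContinuousMap.evalCLM ℝ s

variable [CompleteSpace E]

lemma globalFlow {X : E → E} (hX : ContDiff ℝ 2 X) (y : E) :
    ∃ φ : ℝ × E → E, ContDiffAt ℝ 2 φ (0, y) ∧ (∀ᶠ z in 𝓝 y, φ (0, z) = z) ∧
      ∀ V ∈ 𝓝 y, ∀ᶠ p in 𝓝 ((0:ℝ), y), ∃ γ : ℝ → E, γ 0 = p.2 ∧ γ 1 = φ p ∧
        ∀ s ∈ Ioo (-2 : ℝ) 2, γ s ∈ V ∧ HasDerivAt γ (p.1 • X (γ s)) s := by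
  let XC : C(E, E) := ⟨X, hX.continuous⟩
  let G : (ℝ × E) × C(KK, E) → C(KK, E) := fun q => q.2 - cst E q.1.2 - q.1.1 • volt E (XC.comp q.2)
  have hG : ContDiff ℝ 2 G := by
    have h1 : ContDiff ℝ 2 (fun γ : C(KK, E) => XC.comp γ) := nem_contDiff 2 XC hX
    have h2 : ContDiff ℝ 2 (fun q : (ℝ × E) × C(KK, E) => volt E (XC.comp q.2)) :=
      (volt E).contDiff.comp (h1.comp contDiff_snd)
    have h3 : ContDiff ℝ 2 (fun q : (ℝ × E) × C(KK, E) => cst E q.1.2) :=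
      (cst E).contDiff.comp (contDiff_snd.comp contDiff_fst)
    exact (contDiff_snd.sub h3).sub ((contDiff_fst.comp contDiff_fst).smul h2)
  set u : (ℝ × E) × C(KK, E) := ((0, y), cst E y) with hu
  have hGu : G u = 0 := by simp [G, hu]
  have hG' := hG.contDiffAt (x := u)
  have hinv : (fderiv ℝ G u ∘L .inr ℝ (ℝ × E) C(KK, E)) = ContinuousLinearMap.id ℝ _ := by
    have h1 : HasFDerivAt G (fderiv ℝ G u) ((fun γ => ((0, y), γ) : C(KK,E) → (ℝ × E) × C(KK,E)) (cst E y)) :=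
      (hG'.differentiableAt (by norm_num)).hasFDerivAt
    have h2 := h1.comp (cst E y) (hasFDerivAt_prodMk_right (𝕜 := ℝ) ((0:ℝ), y) (cst E y))
    have h3 : (G ∘ (fun γ => ((0, y), γ) : C(KK,E) → (ℝ × E) × C(KK,E))) = fun γ => γ - cst E y := by
      funext γ; simp [G]
    rw [h3] at h2
    exact h2.unique ((hasFDerivAt_id _).sub_const _)
  have hinv' : (fderiv ℝ G u ∘L .inr ℝ (ℝ × E) C(KK, E)).IsInvertible := by
    rw [hinv]; exact ⟨.refl ℝ _, rfl⟩
  obtain ⟨ψ, hψ⟩ : ∃ ψ, ψ = hG'.implicitFunction (by norm_num) hinv' := ⟨_, rfl⟩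
  have hψ0 : ψ (0, y) = cst E y := by rw [hψ]; exact hG'.implicitFunction_apply_self (by norm_num) hinv'
  have hψc : ContDiffAt ℝ 2 ψ (0, y) := by
    rw [hψ]; exact hG'.contDiffAt_implicitFunction (by norm_num) hinv'
  have hψe : ∀ᶠ p in 𝓝 ((0:ℝ), y), G (p, ψ p) = 0 := by
    rw [hψ, ← hGu]; exact hG'.eventually_apply_implicitFunction (by norm_num) hinv'
  have hψe' : ∀ᶠ p in 𝓝 ((0:ℝ), y), ∀ s : KK, ψ p s = p.2 + p.1 • ∫ r in (0:ℝ)..s,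
      IccExtend (by norm_num) (XC.comp (ψ p)) r := by
    filter_upwards [hψe] with p hp s
    have := congrArg (fun h : C(KK, E) => h s) hp
    simp only [G, ContinuousMap.sub_apply, ContinuousMap.smul_apply, volt_apply, cst_apply,
      ContinuousMap.zero_apply] at this
    rw [sub_sub, sub_eq_zero] at this
    exact this
  have h1m : (1:ℝ) ∈ KK := by constructor <;> norm_num
  refine ⟨fun p => ψ p ⟨1, h1m⟩, ?_, ?_, ?_⟩
  · exact (evl E ⟨1, h1m⟩).contDiff.contDiffAt.comp _ hψc
  · have : Tendsto (fun z : E => ((0:ℝ), z)) (𝓝 y) (𝓝 (0, y)) :=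
      (Continuous.prodMk_right (0:ℝ)).tendsto y
    filter_upwards [this.eventually hψe'] with z hz
    simpa using hz ⟨1, h1m⟩
  · intro V hV
    obtain ⟨r, hr, hrV⟩ := Metric.mem_nhds_iff.1 hV
    have hc : ∀ᶠ p in 𝓝 ((0:ℝ), y), dist (ψ p) (ψ (0, y)) < r :=
      hψc.continuousAt.eventually (Metric.ball_mem_nhds _ hr)
    filter_upwards [hψe', hc] with p hp hpc
    have hcont : Continuous (IccExtend (by norm_num : (-2:ℝ) ≤ 2) (XC.comp (ψ p))) :=
      (XC.comp (ψ p)).continuous.Icc_extend'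
    have heq : ∀ s (hs : s ∈ KK), p.2 + p.1 • ∫ r in (0:ℝ)..s,
      IccExtend (by norm_num) (XC.comp (ψ p)) r = ψ p ⟨s, hs⟩ := fun s hs => (hp ⟨s, hs⟩).symm
    refine ⟨fun s => p.2 + p.1 • ∫ r in (0:ℝ)..s,
      IccExtend (by norm_num) (XC.comp (ψ p)) r, by simp, heq 1 h1m, ?_⟩
    intro s hs
    have hs' : s ∈ KK := Ioo_subset_Icc_self hs
    simp only
    rw [heq s hs']
    refine ⟨hrV ?_, ?_⟩
    · rw [hψ0] at hpc
      exact (ContinuousMap.dist_apply_le_dist (f := ψ p) (g := cst E y) ⟨s, hs'⟩).trans_lt hpc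
    · have := ((hcont.integral_hasStrictDerivAt 0 s).hasDerivAt.const_smul p.1).const_add p.2
      rw [IccExtend_of_mem _ _ hs'] at this
      exact this

lemma localFlow [FiniteDimensional ℝ E] {U : Set E} (hU : IsOpen U) {X : E → E}
    (hX : ContDiffOn ℝ 2 X U) {y : E} (hy : y ∈ U) :
    ∃ φ : ℝ × E → E, ContDiffAt ℝ 2 φ (0, y) ∧ (∀ᶠ z in 𝓝 y, φ (0, z) = z) ∧
      ∀ V ∈ 𝓝 y, ∀ᶠ p in 𝓝 ((0:ℝ), y), ∃ γ : ℝ → E, γ 0 = p.2 ∧ γ 1 = φ p ∧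
        ∀ s ∈ Ioo (-2 : ℝ) 2, γ s ∈ V ∧ HasDerivAt γ (p.1 • X (γ s)) s := by
  obtain ⟨r, hr, hrU⟩ := Metric.nhds_basis_closedBall.mem_iff.1 (hU.mem_nhds hy)
  let χ : ContDiffBump y := ⟨r / 2, r, by positivity, by linarith⟩
  have hg : ContDiff ℝ 2 (fun x => χ x • X x) := by
    rw [contDiff_iff_contDiffAt]
    intro x
    by_cases hx : x ∈ Metric.closedBall y r
    · exact χ.contDiffAt.smul (hX.contDiffAt (hU.mem_nhds (hrU hx)))
    · have : (fun x => χ x • X x) =ᶠ[𝓝 x] fun _ => 0 := by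
        filter_upwards [Metric.isClosed_closedBall.isOpen_compl.mem_nhds hx] with z hz
        have : χ z = 0 := χ.zero_of_le_dist (by simp at hz; exact hz.le)
        simp [this]
      exact contDiffAt_const.congr_of_eventuallyEq this
  obtain ⟨φ, h1, h2, h3⟩ := globalFlow hg y
  refine ⟨φ, h1, h2, fun V hV => ?_⟩
  filter_upwards [h3 (V ∩ Metric.closedBall y (r / 2))
    (inter_mem hV (Metric.closedBall_mem_nhds y (by positivity)))] with p hp
  obtain ⟨γ, g0, g1, hγ⟩ := hp
  refine ⟨γ, g0, g1, fun s hs => ⟨(hγ s hs).1.1, ?_⟩⟩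
  have := (hγ s hs).2
  rwa [χ.one_of_mem_closedBall (hγ s hs).1.2, one_smul] at this

end Flow

section FlowF
variable {E : Type} [NormedAddCommGroup E] [NormedSpace ℝ E]

/-- `f` has derivative `g` along integral curves of `X` in `U`. -/
def HDer (U : Set E) (X : E → E) (f g : E → ℝ) : Prop :=
  ∀ x ∈ U, ∃ α : ℝ → E, α 0 = x ∧
      (∀ᶠ t in nhds (0 : ℝ), α t ∈ U ∧ HasDerivAt α (X (α t)) t) ∧
      HasDerivAt (fun t => f (α t)) (g x) 0

lemma HDer.along {U : Set E} {X : E → E} {f g : E → ℝ} (h : HDer U X f g) (hU : IsOpen U)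
    (hX : ContDiffOn ℝ 2 X U) {γ : ℝ → E} {t s₀ : ℝ}
    (hγ : ∀ᶠ s in 𝓝 s₀, γ s ∈ U ∧ HasDerivAt γ (t • X (γ s)) s) :
    HasDerivAt (fun s => f (γ s)) (t * g (γ s₀)) s₀ := by
  have hmem : γ s₀ ∈ U := hγ.self_of_nhds.1
  obtain ⟨α, h0, h1, h2⟩ := h (γ s₀) hmem
  have hlin : Tendsto (fun s => t * (s - s₀)) (𝓝 s₀) (𝓝 0) := by
    have : Continuous (fun s => t * (s - s₀)) := by fun_prop
    simpa using this.tendsto s₀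
  have hlin' : ∀ s, HasDerivAt (fun s => t * (s - s₀)) t s := by
    intro s
    simpa using ((hasDerivAt_id s).sub_const s₀).const_mul t
  obtain ⟨K, W, hW, hL⟩ := ((((hX.contDiffAt (hU.mem_nhds hmem)).const_smul t).of_le
    one_le_two)).exists_lipschitzOnWith
  have hβ : ∀ᶠ s in 𝓝 s₀, HasDerivAt (fun s => α (t * (s - s₀))) (t • X (α (t * (s - s₀)))) s := by
    filter_upwards [hlin.eventually h1] with s hs
    exact hs.2.scomp s (hlin' s)
  have hβ0 : α (t * (s₀ - s₀)) = γ s₀ := by simp [h0]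
  have hβW : ∀ᶠ s in 𝓝 s₀, α (t * (s - s₀)) ∈ W := by
    have := hβ.self_of_nhds.continuousAt
    exact this (by simpa [h0] using hW)
  have hγW : ∀ᶠ s in 𝓝 s₀, γ s ∈ W := hγ.self_of_nhds.2.continuousAt hW
  have heq : γ =ᶠ[𝓝 s₀] fun s => α (t * (s - s₀)) := by
    refine ODE_solution_unique_of_eventually (v := fun _ x => t • X x) (s := fun _ => W) (K := K)
      (Eventually.of_forall fun _ => hL) ?_ ?_ hβ0.symm
    · filter_upwards [hγ, hγW] with s a b using ⟨a.2, b⟩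
    · filter_upwards [hβ, hβW] with s a b using ⟨a, b⟩
  have hd : HasDerivAt (fun s => f (α (t * (s - s₀)))) (t * g (γ s₀)) s₀ := by
    have h2' : HasDerivAt (fun t => f (α t)) (g (γ s₀)) (t * (s₀ - s₀)) := by simpa using h2
    have := h2'.scomp s₀ (hlin' s₀)
    rw [smul_eq_mul] at this
    exact this
  refine hd.congr_of_eventuallyEq ?_
  filter_upwards [heq] with s hs
  rw [hs]

lemma flowF [CompleteSpace E] [FiniteDimensional ℝ E] {U : Set E} (hU : IsOpen U) {X : E → E}
    (hX : ContDiffOn ℝ 2 X U) {f g : E → ℝ} (hg : ContinuousOn g U) (h : HDer U X f g)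
    {y : E} (hy : y ∈ U) :
    ∃ φ : ℝ × E → E, ContDiffAt ℝ 2 φ (0, y) ∧ φ (0, y) = y ∧
      (∀ τ v, fderiv ℝ φ (0, y) (τ, v) = v + τ • X y) ∧
      (∀ ε > 0, ∀ᶠ p in 𝓝 ((0:ℝ), y), ‖φ p - p.2 - p.1 • X p.2‖ ≤ ε * |p.1|) ∧
      (∀ M, |g y| < M → ∀ᶠ p in 𝓝 ((0:ℝ), y), |f (φ p) - f p.2| ≤ M * |p.1|) := by
  obtain ⟨φ, h1, h2, h3⟩ := localFlow hU hX hy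
  have h4 : ∀ ε > 0, ∀ᶠ p in 𝓝 ((0:ℝ), y), ‖φ p - p.2 - p.1 • X p.2‖ ≤ ε * |p.1| := by
    intro ε hε
    have hXc : ContinuousAt X y := hX.continuousOn.continuousAt (hU.mem_nhds hy)
    have hV : {x | ‖X x - X y‖ < ε / 2} ∈ 𝓝 y := by
      have := hXc.eventually (Metric.ball_mem_nhds (X y) (half_pos hε))
      simp only [Metric.mem_ball, dist_eq_norm] at this
      exact Filter.eventually_iff.1 this
    filter_upwards [h3 _ hV] with p hp
    obtain ⟨γ, g0, g1, hγ⟩ := hp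
    have hin : ∀ s ∈ Icc (0:ℝ) 1, s ∈ Ioo (-2:ℝ) 2 := by
      intro s hs; constructor <;> linarith [hs.1, hs.2]
    have hp2 : ‖X p.2 - X y‖ < ε / 2 := by
      have := (hγ 0 (hin 0 (by simp))).1; rwa [g0] at this
    have := (convex_Icc (0:ℝ) 1).norm_image_sub_le_of_norm_hasDerivWithin_le
      (f := fun s => γ s - s • (p.1 • X p.2)) (f' := fun s => p.1 • X (γ s) - p.1 • X p.2)
      (C := ε * |p.1|) (x := 0) (y := 1)
      (fun s hs => by
        have := (hγ s (hin s hs)).2.sub ((hasDerivAt_id s).smul_const (p.1 • X p.2))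
        rw [one_smul] at this
        exact this.hasDerivWithinAt) (fun s hs => by
        rw [← smul_sub, norm_smul, Real.norm_eq_abs, mul_comm]
        gcongr
        have a := (hγ s (hin s hs)).1
        change ‖X (γ s) - X y‖ < ε / 2 at a
        calc ‖X (γ s) - X p.2‖ = ‖(X (γ s) - X y) - (X p.2 - X y)‖ := by congr 1; abel
          _ ≤ ‖X (γ s) - X y‖ + ‖X p.2 - X y‖ := norm_sub_le _ _
          _ ≤ ε := by linarith) (by simp) (by simp)
    simp only [one_smul, zero_smul, sub_zero, g0, g1, norm_one, mul_one] at this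
    rwa [sub_right_comm] at this
  have h0 : φ (0, y) = y := h2.self_of_nhds
  have hd := (h1.differentiableAt (by norm_num)).hasFDerivAt
  refine ⟨φ, h1, h0, ?_, h4, ?_⟩
  · have hv : ∀ v, fderiv ℝ φ (0, y) (0, v) = v := by
      have a := hd.comp y (hasFDerivAt_prodMk_right (𝕜 := ℝ) (0:ℝ) y)
      have b : HasFDerivAt (φ ∘ fun z => ((0:ℝ), z)) (ContinuousLinearMap.id ℝ E) y :=
        (hasFDerivAt_id y).congr_of_eventuallyEq (by filter_upwards [h2] with z hz using hz)
      intro v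
      have := congrArg (fun L : E →L[ℝ] E => L v) (a.unique b)
      simpa using this
    have ht : fderiv ℝ φ (0, y) (1, 0) = X y := by
      have a := hd.comp (0:ℝ) (hasFDerivAt_prodMk_left (𝕜 := ℝ) (0:ℝ) y)
      have b : HasDerivAt (φ ∘ fun t : ℝ => (t, y)) (X y) 0 := by
        rw [hasDerivAt_iff_isLittleO_nhds_zero, Asymptotics.isLittleO_iff]
        intro ε hε
        have : Tendsto (fun t : ℝ => (t, y)) (𝓝 0) (𝓝 (0, y)) :=
          (Continuous.prodMk_left y).tendsto 0
        filter_upwards [this.eventually (h4 ε hε)] with t ht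
        simpa [h0] using ht
      simpa using a.hasDerivAt.unique b
    intro τ v
    have : ((τ, v) : ℝ × E) = (0, v) + τ • (1, 0) := by simp
    rw [this, map_add, map_smul, hv, ht]
  · intro M hM
    have hV : {x | x ∈ U ∧ |g x| < M} ∈ 𝓝 y := by
      have := ((hg.continuousAt (hU.mem_nhds hy)).abs).eventually (Iio_mem_nhds hM)
      exact Filter.eventually_iff.1 ((hU.eventually_mem hy).and this)
    filter_upwards [h3 _ hV] with p hp
    obtain ⟨γ, g0, g1, hγ⟩ := hp
    have hin : ∀ s ∈ Icc (0:ℝ) 1, s ∈ Ioo (-2:ℝ) 2 := by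
      intro s hs; constructor <;> linarith [hs.1, hs.2]
    have := (convex_Icc (0:ℝ) 1).norm_image_sub_le_of_norm_hasDerivWithin_le
      (f := fun s => f (γ s)) (f' := fun s => p.1 * g (γ s))
      (C := M * |p.1|) (x := 0) (y := 1)
      (fun s hs => (h.along hU hX (by
        filter_upwards [isOpen_Ioo.mem_nhds (hin s hs)] with r hr
        exact ⟨(hγ r hr).1.1, (hγ r hr).2⟩)).hasDerivWithinAt) (fun s hs => by
        rw [norm_mul, Real.norm_eq_abs, Real.norm_eq_abs, mul_comm]
        gcongr
        exact (hγ s (hin s hs)).1.2.le) (by simp) (by simp)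
    simpa [g0, g1] using this

end FlowF

section Bracket
variable {E F : Type} [NormedAddCommGroup E] [NormedSpace ℝ E]
  [NormedAddCommGroup F] [NormedSpace ℝ F] [FiniteDimensional ℝ E] [FiniteDimensional ℝ F]

lemma tangent_coeff {φ : F → E} {s : F} (hφ : ContDiffAt ℝ 2 φ s)
    (hinj : Function.Injective (fderiv ℝ φ s)) {X : E → E} (hX : DifferentiableAt ℝ X (φ s))
    (tX : ∀ᶠ r in 𝓝 s, ∃ v, X (φ r) = fderiv ℝ φ r v) :
    ∃ a : F → F, DifferentiableAt ℝ a s ∧ ∀ᶠ r in 𝓝 s, X (φ r) = fderiv ℝ φ r (a r) := by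
  haveI : CompleteSpace F := FiniteDimensional.complete ℝ F
  obtain ⟨L₀, hL₀⟩ := (fderiv ℝ φ s).toLinearMap.exists_leftInverse_of_injective
    (LinearMap.ker_eq_bot.2 hinj)
  let L : E →L[ℝ] F := LinearMap.toContinuousLinearMap L₀
  have hL : ∀ v, L (fderiv ℝ φ s v) = v := fun v => congrArg (fun l : F →ₗ[ℝ] F => l v) hL₀
  have hD : DifferentiableAt ℝ (fderiv ℝ φ) s :=
    (hφ.fderiv_right (m := 1) (by norm_num)).differentiableAt (by norm_num)
  let A : F → (F →L[ℝ] F) := fun r => L.comp (fderiv ℝ φ r)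
  have hA : DifferentiableAt ℝ A s := (differentiableAt_const L).clm_comp hD
  have hAs : A s = 1 := by ext v; simp [A, hL]
  have hinv : DifferentiableAt ℝ (fun r => Ring.inverse (A r)) s := by
    have h1 : DifferentiableAt ℝ (Ring.inverse : (F →L[ℝ] F) → _) (A s) := by
      rw [hAs]
      exact differentiableAt_inverse isUnit_one
    exact h1.comp s hA
  have hunit : ∀ᶠ r in 𝓝 s, IsUnit (A r) := by
    have : IsOpen {x : F →L[ℝ] F | IsUnit x} := Units.isOpen
    exact hA.continuousAt.eventually (this.eventually_mem (by rw [hAs]; exact isUnit_one))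
  refine ⟨fun r => Ring.inverse (A r) (L (X (φ r))), ?_, ?_⟩
  · refine hinv.clm_apply ?_
    exact L.differentiableAt.comp s (hX.comp s (hφ.differentiableAt (by norm_num)))
  · filter_upwards [hunit, tX] with r hr ⟨v, hv⟩
    have : Ring.inverse (A r) (L (X (φ r))) = v := by
      rw [hv]
      exact congrArg (fun l : F →L[ℝ] F => l v) (Ring.inverse_mul_cancel _ hr)
    rw [this, hv]

lemma bracket_tangent {φ : F → E} {s : F} (hφ : ContDiffAt ℝ 2 φ s)
    (hinj : Function.Injective (fderiv ℝ φ s)) {X Y : E → E} (hX : DifferentiableAt ℝ X (φ s))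
    (hY : DifferentiableAt ℝ Y (φ s))
    (tX : ∀ᶠ r in 𝓝 s, ∃ v, X (φ r) = fderiv ℝ φ r v)
    (tY : ∀ᶠ r in 𝓝 s, ∃ v, Y (φ r) = fderiv ℝ φ r v) :
    ∃ v, fderiv ℝ Y (φ s) (X (φ s)) - fderiv ℝ X (φ s) (Y (φ s)) = fderiv ℝ φ s v := by
  obtain ⟨a, ha, haX⟩ := tangent_coeff hφ hinj hX tX
  obtain ⟨b, hb, hbY⟩ := tangent_coeff hφ hinj hY tY
  have hD : DifferentiableAt ℝ (fderiv ℝ φ) s :=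
    (hφ.fderiv_right (m := 1) (by norm_num)).differentiableAt (by norm_num)
  have key : ∀ {X : E → E} {a : F → F}, DifferentiableAt ℝ X (φ s) → DifferentiableAt ℝ a s →
      (∀ᶠ r in 𝓝 s, X (φ r) = fderiv ℝ φ r (a r)) → ∀ w, fderiv ℝ X (φ s) (fderiv ℝ φ s w) =
        fderiv ℝ (fderiv ℝ φ) s w (a s) + fderiv ℝ φ s (fderiv ℝ a s w) := by
    intro X a hX ha haX w
    have h1 := hX.hasFDerivAt.comp s (hφ.differentiableAt (by norm_num)).hasFDerivAt
    have h2 := hD.hasFDerivAt.clm_apply ha.hasFDerivAt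
    have h3 := h1.congr_of_eventuallyEq (f₁ := fun r => fderiv ℝ φ r (a r))
      (by filter_upwards [haX] with r hr using hr.symm)
    have := congrArg (fun l : F →L[ℝ] E => l w) (h3.unique h2)
    simp at this
    rw [this]; abel
  have hsym : IsSymmSndFDerivAt ℝ φ s := hφ.isSymmSndFDerivAt (by simp)
  refine ⟨fderiv ℝ b s (a s) - fderiv ℝ a s (b s), ?_⟩
  rw [haX.self_of_nhds, hbY.self_of_nhds, key hX ha haX, key hY hb hbY, map_sub, hsym.eq (a s) (b s)]
  abel

end Bracket

section Chow
variable {n k : ℕ}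

lemma lieHull_smooth {U : Set (Fin n → ℝ)} (hU : IsOpen U) {X : Fin k → (Fin n → ℝ) → (Fin n → ℝ)}
    (hX : ∀ i, ContDiffOn ℝ (⊤ : ℕ∞) (X i) U) {Z} (hZ : LieHull (range X) Z) :
    ContDiffOn ℝ (⊤ : ℕ∞) Z U := by
  induction hZ with
  | base h => obtain ⟨i, rfl⟩ := h; exact hX i
  | br _ _ h1 h2 =>
    refine ContDiffOn.sub ?_ ?_
    · exact (h2.fderiv_of_isOpen hU (by simp)).clm_apply h1
    · exact (h1.fderiv_of_isOpen hU (by simp)).clm_apply h2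

lemma lieHull_tangent {F : Type} [NormedAddCommGroup F] [NormedSpace ℝ F] [FiniteDimensional ℝ F]
    {U : Set (Fin n → ℝ)} (hU : IsOpen U) {X : Fin k → (Fin n → ℝ) → (Fin n → ℝ)}
    (hX : ∀ i, ContDiffOn ℝ (⊤ : ℕ∞) (X i) U) {φ : F → (Fin n → ℝ)} {s : F}
    (hφ : ∀ᶠ r in 𝓝 s, ContDiffAt ℝ 2 φ r ∧ Function.Injective (fderiv ℝ φ r) ∧ φ r ∈ U)
    (tX : ∀ᶠ r in 𝓝 s, ∀ i, ∃ v, X i (φ r) = fderiv ℝ φ r v)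
    {Z} (hZ : LieHull (range X) Z) : ∀ᶠ r in 𝓝 s, ∃ v, Z (φ r) = fderiv ℝ φ r v := by
  induction hZ with
  | base h => obtain ⟨i, rfl⟩ := h; filter_upwards [tX] with r hr using hr i
  | br z1 z2 h1 h2 =>
    filter_upwards [hφ, h1.eventually_nhds, h2.eventually_nhds] with r hr e1 e2
    have d1 := ((lieHull_smooth hU hX z1).contDiffAt (hU.mem_nhds hr.2.2)).differentiableAt (by simp)
    have d2 := ((lieHull_smooth hU hX z2).contDiffAt (hU.mem_nhds hr.2.2)).differentiableAt (by simp)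
    exact bracket_tangent hr.1 hr.2.1 d1 d2 e1 e2

end Chow

section Chow2
variable {n k : ℕ}

/-- A `j`-dimensional family of points reachable from `x`, with control of `f`. -/
def Fam (U : Set (Fin n → ℝ)) (f : (Fin n → ℝ) → ℝ) (x : Fin n → ℝ) (ε : ℝ) (j : ℕ) : Prop :=
  ∃ (s : Fin j → ℝ) (Φ : (Fin j → ℝ) × (Fin n → ℝ) → (Fin n → ℝ)),
    ContDiffAt ℝ 2 Φ (s, x) ∧ Φ (s, x) ∈ U ∧
    Function.Injective (fderiv ℝ (fun r => Φ (r, x)) s) ∧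
    ∀ᶠ p in 𝓝 (s, x), |f (Φ p) - f p.2| ≤ ε

lemma fam_step {U : Set (Fin n → ℝ)} (hU : IsOpen U) {X : Fin k → (Fin n → ℝ) → (Fin n → ℝ)}
    (hX : ∀ i, ContDiffOn ℝ (⊤ : ℕ∞) (X i) U) (hbg : BracketGenerating U (Set.range X))
    {f : (Fin n → ℝ) → ℝ} {g : Fin k → (Fin n → ℝ) → ℝ} (hgC : ∀ i, ContinuousOn (g i) U)
    (hder : ∀ i, HDer U (X i) f (g i)) {x : Fin n → ℝ} {ε δ : ℝ} (hδ : 0 < δ) {j : ℕ} (hj : j < n)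
    (h : Fam U f x ε j) : Fam U f x (ε + δ) (j + 1) := by
  obtain ⟨s, Φ, hΦ, hΦU, hinj, hf⟩ := h
  set φ : (Fin j → ℝ) → (Fin n → ℝ) := fun r => Φ (r, x) with hφdef
  have hT : Tendsto (fun r : Fin j → ℝ => (r, x)) (𝓝 s) (𝓝 (s, x)) :=
    (Continuous.prodMk_left x).tendsto s
  have hcd : ∀ r, ContDiffAt ℝ 2 Φ (r, x) → ContDiffAt ℝ 2 φ r := fun r hr =>
    ContDiffAt.comp (f := fun r => (r, x)) r hr (contDiffAt_id.prodMk contDiffAt_const)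
  have e1 : ∀ᶠ r in 𝓝 s, ContDiffAt ℝ 2 Φ (r, x) := hT.eventually (hΦ.eventually (by simp))
  have e2 : ∀ᶠ r in 𝓝 s, φ r ∈ U :=
    (hcd s hΦ).continuousAt.eventually (hU.eventually_mem hΦU)
  have e3 : ∀ᶠ r in 𝓝 s, Function.Injective (fderiv ℝ φ r) := by
    have hc : ContinuousAt (fderiv ℝ φ) s :=
      ((hcd s hΦ).fderiv_right (m := 1) (by norm_num)).continuousAt
    exact hc.eventually (ContinuousLinearMap.isOpen_injective.eventually_mem hinj)
  have e4 : ∀ᶠ r in 𝓝 s, ∀ᶠ p in 𝓝 (r, x), |f (Φ p) - f p.2| ≤ ε :=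
    hT.eventually hf.eventually_nhds
  have hfreq : ∃ᶠ r in 𝓝 s, ∃ i, ∀ v, X i (φ r) ≠ fderiv ℝ φ r v := by
    intro hnot
    have tX : ∀ᶠ r in 𝓝 s, ∀ i, ∃ v, X i (φ r) = fderiv ℝ φ r v := by
      filter_upwards [hnot] with r hr
      push Not at hr
      exact hr
    have hall : ∀ Z, LieHull (range X) Z → ∃ v, Z (φ s) = fderiv ℝ φ s v := by
      intro Z hZ
      refine (lieHull_tangent hU hX ?_ tX hZ).self_of_nhds
      filter_upwards [e1, e2, e3] with r a b c using ⟨hcd r a, c, b⟩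
    have hspan := hbg (φ s) hΦU
    have hle : (⊤ : Submodule ℝ (Fin n → ℝ)) ≤ LinearMap.range (fderiv ℝ φ s).toLinearMap := by
      rw [← hspan, Submodule.span_le]
      rintro _ ⟨Z, hZ, rfl⟩
      obtain ⟨v, hv⟩ := hall Z hZ
      exact ⟨v, hv.symm⟩
    have h1 := LinearMap.finrank_range_le (fderiv ℝ φ s).toLinearMap
    rw [top_le_iff.1 hle, finrank_top] at h1
    simp at h1
    omega
  obtain ⟨r, ⟨i, hi⟩, r1, r2, r3, r4⟩ :=
    (hfreq.and_eventually (e1.and (e2.and (e3.and e4)))).exists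
  obtain ⟨ψ, p1, p2, p3, -, p5⟩ := flowF hU (contDiffOn_infty.1 (hX i) 2) (hgC i) (hder i) r2
  let T : (Fin (j + 1) → ℝ) →L[ℝ] (Fin j → ℝ) :=
    ContinuousLinearMap.pi (fun m => ContinuousLinearMap.proj m.succ)
  let P : (Fin (j + 1) → ℝ) →L[ℝ] ℝ := ContinuousLinearMap.proj 0
  let s' : Fin (j + 1) → ℝ := Fin.cons 0 r
  have hTs : T s' = r := by ext m; simp [T, s']
  have hPs : P s' = 0 := by simp [P, s']
  let Q : (Fin (j + 1) → ℝ) × (Fin n → ℝ) → ℝ × (Fin n → ℝ) := fun q => (P q.1, Φ (T q.1, q.2))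
  have hQs : Q (s', x) = (0, φ r) := by simp [Q, hTs, hPs, hφdef]
  have hin : ContDiffAt ℝ 2 (fun q : (Fin (j + 1) → ℝ) × (Fin n → ℝ) => (T q.1, q.2)) (s', x) :=
    (T.contDiff.contDiffAt.comp _ contDiffAt_fst).prodMk contDiffAt_snd
  have hΦ' : ContDiffAt ℝ 2 (fun q : (Fin (j + 1) → ℝ) × (Fin n → ℝ) => Φ (T q.1, q.2)) (s', x) :=
    ContDiffAt.comp (g := Φ) (s', x) (by simpa [hTs] using r1) hin
  have hQ : ContDiffAt ℝ 2 Q (s', x) := (P.contDiff.contDiffAt.comp _ contDiffAt_fst).prodMk hΦ'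
  refine ⟨s', fun q => ψ (Q q), ?_, ?_, ?_, ?_⟩
  · exact ContDiffAt.comp (g := ψ) (s', x) (by rw [hQs]; exact p1) hQ
  · change ψ (Q (s', x)) ∈ U
    rw [hQs, p2]; exact r2
  · have d1 : HasFDerivAt φ (fderiv ℝ φ r) (T s') := by
      rw [hTs]; exact ((hcd r r1).differentiableAt (by norm_num)).hasFDerivAt
    have d2 : HasFDerivAt (fun r' => (P r', φ (T r'))) (P.prod ((fderiv ℝ φ r).comp T)) s' :=
      P.hasFDerivAt.prodMk (d1.comp s' T.hasFDerivAt)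
    have d3 : HasFDerivAt ψ (fderiv ℝ ψ (0, φ r)) (P s', φ (T s')) := by
      rw [hTs, hPs]; exact (p1.differentiableAt (by norm_num)).hasFDerivAt
    have d4 := d3.comp s' d2
    have d5 : fderiv ℝ (fun r' => ψ (Q (r', x))) s' = _ := d4.fderiv
    rw [d5, injective_iff_map_eq_zero]
    intro σ hσ
    simp only [ContinuousLinearMap.comp_apply, ContinuousLinearMap.prod_apply, p3] at hσ
    have h0 : P σ = 0 := by
      by_contra hne
      apply hi (-(P σ)⁻¹ • T σ)
      rw [map_smul]
      have : fderiv ℝ φ r (T σ) = - (P σ • X i (φ r)) := eq_neg_of_add_eq_zero_left hσ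
      rw [this, smul_neg, neg_smul, neg_neg, smul_smul, inv_mul_cancel₀ hne, one_smul]
    rw [h0, zero_smul, add_zero] at hσ
    have hT0 : T σ = 0 := r3 (by rw [hσ, map_zero])
    ext m
    refine Fin.cases ?_ (fun m => ?_) m
    · exact h0
    · exact congrFun hT0 m
  · have hM : 0 < |g i (φ r)| + 1 := by positivity
    have q1 := hQ.continuousAt
    have q2 := hin.continuousAt
    rw [ContinuousAt, hQs] at q1
    rw [ContinuousAt] at q2
    simp only [hTs] at q2
    have q3 : ∀ᶠ q in 𝓝 (s', x), |(Q q).1| ≤ δ / (|g i (φ r)| + 1) := by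
      have : Tendsto (fun q => |(Q q).1|) (𝓝 (s', x)) (𝓝 0) := by
        simpa using ((continuous_fst.tendsto _).comp q1).abs
      exact (this.eventually (Iio_mem_nhds (div_pos hδ hM))).mono fun _ h => le_of_lt h
    filter_upwards [q1.eventually (p5 _ (lt_add_one _)), q2.eventually r4, q3] with q a b c
    have c' : (|g i (φ r)| + 1) * |(Q q).1| ≤ δ := by
      calc _ ≤ (|g i (φ r)| + 1) * (δ / (|g i (φ r)| + 1)) := by gcongr
        _ = δ := by field_simp
    calc |f (ψ (Q q)) - f q.2| = |(f (ψ (Q q)) - f (Q q).2) + (f (Φ (T q.1, q.2)) - f q.2)| := by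
          congr 1; simp [Q]
      _ ≤ |f (ψ (Q q)) - f (Q q).2| + |f (Φ (T q.1, q.2)) - f q.2| := abs_add_le _ _
      _ ≤ ε + δ := by linarith

lemma fam_all {U : Set (Fin n → ℝ)} (hU : IsOpen U) {X : Fin k → (Fin n → ℝ) → (Fin n → ℝ)}
    (hX : ∀ i, ContDiffOn ℝ (⊤ : ℕ∞) (X i) U) (hbg : BracketGenerating U (Set.range X))
    {f : (Fin n → ℝ) → ℝ} {g : Fin k → (Fin n → ℝ) → ℝ} (hgC : ∀ i, ContinuousOn (g i) U)
    (hder : ∀ i, HDer U (X i) f (g i)) {x : Fin n → ℝ} (hx : x ∈ U) (j : ℕ) (hj : j ≤ n) :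
    ∀ ε > 0, Fam U f x ε j := by
  induction j with
  | zero =>
    intro ε hε
    refine ⟨0, fun p => p.2, contDiffAt_snd, hx, Function.injective_of_subsingleton _, ?_⟩
    exact Eventually.of_forall fun p => by simpa using hε.le
  | succ j ih =>
    intro ε hε
    have := fam_step hU hX hbg hgC hder (half_pos hε) (by omega) (ih (by omega) _ (half_pos hε))
    rwa [add_halves] at this

lemma f_continuousAt {U : Set (Fin n → ℝ)} (hU : IsOpen U)
    {X : Fin k → (Fin n → ℝ) → (Fin n → ℝ)}
    (hX : ∀ i, ContDiffOn ℝ (⊤ : ℕ∞) (X i) U) (hbg : BracketGenerating U (Set.range X))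
    {f : (Fin n → ℝ) → ℝ} {g : Fin k → (Fin n → ℝ) → ℝ} (hgC : ∀ i, ContinuousOn (g i) U)
    (hder : ∀ i, HDer U (X i) f (g i)) {x : Fin n → ℝ} (hx : x ∈ U) : ContinuousAt f x := by
  rw [Metric.continuousAt_iff']
  intro ε hε
  obtain ⟨s, Φ, hΦ, hΦU, hinj, hf⟩ := fam_all hU hX hbg hgC hder hx n le_rfl (ε / 3) (by positivity)
  have hcd : ContDiffAt ℝ 2 (fun r => Φ (r, x)) s :=
    ContDiffAt.comp (f := fun r => (r, x)) s hΦ (contDiffAt_id.prodMk contDiffAt_const)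
  have hstrict := hcd.hasStrictFDerivAt (by norm_num)
  have hsurj : (fderiv ℝ (fun r => Φ (r, x)) s).range = ⊤ := by
    rw [LinearMap.range_eq_top]
    exact LinearMap.injective_iff_surjective.1 hinj
  have hmap := hstrict.map_nhds_eq_of_surj hsurj
  have hT : Tendsto (fun r : Fin n → ℝ => (r, x)) (𝓝 s) (𝓝 (s, x)) :=
    (Continuous.prodMk_left x).tendsto s
  have hT' : Tendsto (fun z : Fin n → ℝ => (s, z)) (𝓝 x) (𝓝 (s, x)) :=
    (Continuous.prodMk_right s).tendsto x
  have w : ∀ᶠ w in 𝓝 (Φ (s, x)), |f w - f x| ≤ ε / 3 := by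
    rw [← hmap, eventually_map]
    exact hT.eventually hf
  have w' : ∀ᶠ z in 𝓝 x, |f (Φ (s, z)) - f x| ≤ ε / 3 :=
    (hΦ.continuousAt.tendsto.comp hT').eventually w
  filter_upwards [w', hT'.eventually hf] with z a b
  rw [Real.dist_eq]
  rw [abs_le] at a b
  rw [abs_lt]
  constructor <;> linarith [a.1, a.2, b.1, b.2]

end Chow2

section Lip
variable {n k : ℕ}

lemma multiStep {U : Set (Fin n → ℝ)} (hU : IsOpen U)
    {X : Fin k → (Fin n → ℝ) → (Fin n → ℝ)}
    (hX : ∀ i, ContDiffOn ℝ (⊤ : ℕ∞) (X i) U)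
    {f : (Fin n → ℝ) → ℝ} {g : Fin k → (Fin n → ℝ) → ℝ} (hgC : ∀ i, ContinuousOn (g i) U)
    (hder : ∀ i, HDer U (X i) f (g i)) {C : ℝ} (hC : ∀ i, ∀ x ∈ U, |g i x| < C)
    {y : Fin n → ℝ} (hy : y ∈ U) (A : Finset (Fin k)) :
    ∃ Ψ : (Fin k → ℝ) × (Fin n → ℝ) → (Fin n → ℝ), Tendsto Ψ (𝓝 (0, y)) (𝓝 y) ∧
      (∀ ε > 0, ∀ᶠ p in 𝓝 ((0 : Fin k → ℝ), y),
        ‖Ψ p - p.2 - ∑ i ∈ A, p.1 i • X i p.2‖ ≤ ε * ∑ i ∈ A, |p.1 i|) ∧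
      ∀ᶠ p in 𝓝 ((0 : Fin k → ℝ), y), |f (Ψ p) - f p.2| ≤ C * ∑ i ∈ A, |p.1 i| := by
  induction A using Finset.induction_on with
  | empty =>
    exact ⟨fun p => p.2, continuous_snd.tendsto _, fun ε _ => by simp, by simp⟩
  | insert i A hi ih =>
    obtain ⟨Ψ, h1, h2, h3⟩ := ih
    obtain ⟨ψ, p1, p2, -, p4, p5⟩ := flowF hU (contDiffOn_infty.1 (hX i) 2) (hgC i) (hder i) hy
    have hQ : Tendsto (fun p : (Fin k → ℝ) × (Fin n → ℝ) => (p.1 i, Ψ p)) (𝓝 (0, y))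
        (𝓝 ((0:ℝ), y)) := by
      refine Tendsto.prodMk_nhds ?_ h1
      have : Continuous (fun p : (Fin k → ℝ) × (Fin n → ℝ) => p.1 i) := by fun_prop
      exact this.tendsto _
    have hXc : ContinuousAt (X i) y := (hX i).continuousOn.continuousAt (hU.mem_nhds hy)
    refine ⟨fun p => ψ (p.1 i, Ψ p), ?_, ?_, ?_⟩
    · have := p1.continuousAt.tendsto
      rw [p2] at this
      exact this.comp hQ
    · intro ε hε
      have hd : ∀ᶠ p in 𝓝 ((0 : Fin k → ℝ), y), ‖X i (Ψ p) - X i p.2‖ < ε / 2 := by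
        have a := hXc.tendsto.comp h1
        have b : Tendsto (fun p : (Fin k → ℝ) × (Fin n → ℝ) => X i p.2) (𝓝 (0, y)) (𝓝 (X i y)) :=
          hXc.tendsto.comp (continuous_snd.tendsto _)
        have c := (a.sub b).norm
        rw [sub_self, norm_zero] at c
        exact c.eventually (Iio_mem_nhds (half_pos hε))
      filter_upwards [hQ.eventually (p4 _ (half_pos hε)), h2 ε hε, hd] with p a b c
      rw [Finset.sum_insert hi, Finset.sum_insert hi]
      have e : ψ (p.1 i, Ψ p) - p.2 - (p.1 i • X i p.2 + ∑ i ∈ A, p.1 i • X i p.2) =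
          (ψ (p.1 i, Ψ p) - Ψ p - p.1 i • X i (Ψ p)) + (Ψ p - p.2 - ∑ i ∈ A, p.1 i • X i p.2)
          + p.1 i • (X i (Ψ p) - X i p.2) := by
        rw [smul_sub]; abel
      rw [e]
      have d : ‖p.1 i • (X i (Ψ p) - X i p.2)‖ ≤ ε / 2 * |p.1 i| := by
        rw [norm_smul, Real.norm_eq_abs, mul_comm]
        gcongr
      refine (norm_add₃_le).trans ?_
      linarith
    · filter_upwards [hQ.eventually (p5 C (hC i y hy)), h3] with p a b
      rw [Finset.sum_insert hi]
      have := abs_add_le (f (ψ (p.1 i, Ψ p)) - f (Ψ p)) (f (Ψ p) - f p.2)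
      rw [sub_add_sub_cancel] at this
      linarith

lemma controlled_lip {U : Set (Fin n → ℝ)} (hU : IsOpen U)
    {X : Fin k → (Fin n → ℝ) → (Fin n → ℝ)}
    (hX : ∀ i, ContDiffOn ℝ (⊤ : ℕ∞) (X i) U)
    {f : (Fin n → ℝ) → ℝ} (hf : ContinuousOn f U)
    {g : Fin k → (Fin n → ℝ) → ℝ} (hgC : ∀ i, ContinuousOn (g i) U)
    (hder : ∀ i, HDer U (X i) f (g i)) {C : ℝ} (hC0 : 0 ≤ C) (hC : ∀ i, ∀ x ∈ U, |g i x| < C)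
    {γ : ℝ → (Fin n → ℝ)} {a b : ℝ} {u : Fin k → ℝ → ℝ} (hγ : IsControlledOn U X γ a b u) :
    |f (γ b) - f (γ a)| ≤ C * ∫ s in a..b, ∑ i, |u i s| := by
  obtain ⟨hab, hγU, hγc, hu, hint, hγe⟩ := hγ
  set v : ℝ → ℝ := fun s => ∑ i, |u i s| with hv
  have hv0 : ∀ s, 0 ≤ v s := fun s => Finset.sum_nonneg fun i _ => abs_nonneg _
  have hvi : IntegrableOn v (Icc a b) := integrable_finsetSum _ fun i _ => (hu i).abs
  have sub : ∀ {G : Type} [NormedAddCommGroup G] {h : ℝ → G}, IntegrableOn h (Icc a b) →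
      ∀ {p q}, a ≤ p → p ≤ q → q ≤ b → IntervalIntegrable h volume p q := by
    intro G _ h hh p q h1 h2 h3
    rw [intervalIntegrable_iff_integrableOn_Icc_of_le h2]
    exact hh.mono_set (Icc_subset_Icc h1 h3)
  set w : ℝ → ℝ := fun t => ∫ s in a..t, v s with hw
  have hwc : ContinuousOn w (Icc a b) := by
    have := intervalIntegral.continuousOn_primitive_interval (a := a) (b := b) (f := v) (μ := volume)
      (by rwa [uIcc_of_le hab])
    rwa [uIcc_of_le hab] at this
  have hwadd : ∀ t h, a ≤ t → t ≤ h → h ≤ b → w h = w t + ∫ s in t..h, v s := by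
    intro t h h1 h2 h3
    exact (intervalIntegral.integral_add_adjacent_intervals (sub hvi le_rfl h1 (h2.trans h3))
      (sub hvi h1 h2 h3)).symm
  have hδ0 : ∀ t h, t ≤ h → 0 ≤ ∫ s in t..h, v s := fun t h hth =>
    intervalIntegral.integral_nonneg hth fun s _ => hv0 s
  have hw0 : ∀ t, a ≤ t → 0 ≤ w t := fun t ht => hδ0 a t ht
  -- compact neighbourhood of the curve
  have hcomp : IsCompact (γ '' Icc a b) := isCompact_Icc.image_of_continuousOn hγc
  obtain ⟨ρ, hρ, hρU⟩ := hcomp.exists_cthickening_subset_open hU (by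
    rintro _ ⟨t, ht, rfl⟩; exact hγU t ht)
  set K1 := Metric.cthickening ρ (γ '' Icc a b) with hK1
  have hK1c : IsCompact K1 := hcomp.cthickening
  have hmemK : ∀ t ∈ Icc a b, ∀ σ, ‖σ - γ t‖ ≤ ρ → σ ∈ K1 := fun t ht σ h =>
    Metric.mem_cthickening_of_dist_le σ (γ t) ρ _ (mem_image_of_mem _ ht) (by rwa [dist_eq_norm])
  have hLex : ∃ L : ℝ, 0 ≤ L ∧ ∀ i, ∀ x ∈ K1, ‖fderiv ℝ (X i) x‖ ≤ L := by
    have : ∀ i, ∃ L : ℝ, ∀ x ∈ K1, ‖fderiv ℝ (X i) x‖ ≤ L := fun i =>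
      hK1c.exists_bound_of_continuousOn
        (((hX i).continuousOn_fderiv_of_isOpen hU (by simp)).mono hρU)
    choose L hL using this
    refine ⟨∑ i, |L i|, Finset.sum_nonneg fun i _ => abs_nonneg _, fun i x hx => ?_⟩
    exact (hL i x hx).trans ((le_abs_self _).trans
      (Finset.single_le_sum (f := fun i => |L i|) (fun i _ => abs_nonneg _) (Finset.mem_univ i)))
  obtain ⟨L, hL0, hL⟩ := hLex
  have hLip : ∀ i, ∀ t ∈ Icc a b, ∀ σ, ‖σ - γ t‖ ≤ ρ →
      ‖X i σ - X i (γ t)‖ ≤ L * ‖σ - γ t‖ := by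
    intro i t ht σ hσ
    have hball : ∀ x ∈ Metric.closedBall (γ t) ρ, x ∈ K1 := fun x hx =>
      hmemK t ht x (by rwa [mem_closedBall_iff_norm] at hx)
    exact (convex_closedBall (γ t) ρ).norm_image_sub_le_of_norm_hasFDerivWithin_le (𝕜 := ℝ)
      (f' := fun x => fderiv ℝ (X i) x)
      (fun x hx => (((hX i).contDiffAt (hU.mem_nhds (hρU (hball x hx)))).differentiableAt
        (by simp)).hasFDerivAt.hasFDerivWithinAt)
      (fun x hx => hL i x (hball x hx)) (Metric.mem_closedBall_self hρ.le)
      (by rwa [mem_closedBall_iff_norm])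
  set B : ℝ → ℝ := fun r => 2 * r * Real.exp (L * r) with hB
  have hBc : Continuous B := by fun_prop
  have hBmono : ∀ r r', 0 ≤ r → r ≤ r' → B r ≤ B r' := by
    intro r r' h1 h2
    have h3 : 0 ≤ r' := h1.trans h2
    simp only [hB]
    gcongr
  have hBstep : ∀ r δ, 0 ≤ r → 0 ≤ δ → B r * (1 + L * δ) + 2 * δ ≤ B (r + δ) := by
    intro r δ h1 h2
    have e1 : 1 + L * δ ≤ Real.exp (L * δ) := by linarith [Real.add_one_le_exp (L * δ)]
    have e2 : 1 ≤ Real.exp (L * r) := Real.one_le_exp (by positivity)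
    have e3 : 1 ≤ Real.exp (L * δ) := Real.one_le_exp (by positivity)
    have e4 : 1 ≤ Real.exp (L * r) * Real.exp (L * δ) := one_le_mul_of_one_le_of_one_le e2 e3
    calc B r * (1 + L * δ) + 2 * δ
        ≤ 2 * r * Real.exp (L * r) * Real.exp (L * δ)
            + 2 * δ * (Real.exp (L * r) * Real.exp (L * δ)) := by
          refine add_le_add ?_ ?_
          · exact mul_le_mul_of_nonneg_left e1 (by positivity)
          · exact le_mul_of_one_le_right (by positivity) e4
      _ = B (r + δ) := by simp only [hB]; rw [mul_add L, Real.exp_add]; ring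
  have hB0 : ∀ r, 0 ≤ r → 0 ≤ B r := by intro r h; simp only [hB]; positivity
  -- main approximation claim
  have main : ∀ η > 0, η * B (w b) ≤ ρ → ∃ σ, ‖σ - γ b‖ ≤ η * B (w b) ∧
      |f σ - f (γ a)| ≤ C * w b := by
    intro η hη hηρ
    set S : Set ℝ := {t | t ∈ Icc a b ∧ ∃ σ ∈ K1, ‖σ - γ t‖ ≤ η * B (w t) ∧
      |f σ - f (γ a)| ≤ C * w t} with hS
    have hSclosed : IsClosed (S ∩ Icc a b) := by
      have hP : IsCompact (Icc a b ×ˢ K1) := isCompact_Icc.prod hK1c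
      have c1 : ContinuousOn (fun p : ℝ × (Fin n → ℝ) => γ p.1) (Icc a b ×ˢ K1) :=
        hγc.comp continuousOn_fst fun p hp => hp.1
      have c2 : ContinuousOn (fun p : ℝ × (Fin n → ℝ) => w p.1) (Icc a b ×ˢ K1) :=
        hwc.comp continuousOn_fst fun p hp => hp.1
      have c3 : ContinuousOn (fun p : ℝ × (Fin n → ℝ) => f p.2) (Icc a b ×ˢ K1) :=
        (hf.mono hρU).comp continuousOn_snd fun p hp => hp.2
      have k1 : IsClosed {p ∈ Icc a b ×ˢ K1 | ‖p.2 - γ p.1‖ ≤ η * B (w p.1)} :=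
        hP.isClosed.isClosed_le (continuousOn_snd.sub c1).norm
          (continuousOn_const.mul (hBc.comp_continuousOn c2))
      have k2 : IsClosed {p ∈ Icc a b ×ˢ K1 | |f p.2 - f (γ a)| ≤ C * w p.1} :=
        hP.isClosed.isClosed_le (c3.sub continuousOn_const).abs (continuousOn_const.mul c2)
      have k3 := ((hP.inter_right k1).inter_right k2).image continuous_fst
      convert k3.isClosed using 1
      ext t
      constructor
      · rintro ⟨⟨h1, σ, h2, h3, h4⟩, -⟩
        exact ⟨(t, σ), ⟨⟨⟨h1, h2⟩, ⟨h1, h2⟩, h3⟩, ⟨h1, h2⟩, h4⟩, rfl⟩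
      · rintro ⟨⟨t', σ⟩, ⟨⟨⟨h1, h2⟩, -, h3⟩, -, h4⟩, rfl⟩
        exact ⟨⟨h1, σ, h2, h3, h4⟩, h1⟩
    have hSa : a ∈ S := by
      refine ⟨left_mem_Icc.2 hab, γ a, hmemK a (left_mem_Icc.2 hab) _ (by simpa using hρ.le), ?_, ?_⟩
      · simp [hw, hB]
      · simp [hw]
    have hstep : ∀ t ∈ S ∩ Ico a b, ∀ y ∈ Ioi t, (S ∩ Ioc t y).Nonempty := by
      rintro t ⟨⟨htI, σ, hσK, hσ, hσf⟩, hta, htb⟩ y hy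
      obtain ⟨Ψ, -, m1, m2⟩ := multiStep hU hX hgC hder hC (hρU hσK) Finset.univ
      have hσρ : ‖σ - γ t‖ ≤ ρ := hσ.trans (le_trans
        (mul_le_mul_of_nonneg_left (hBmono _ _ (hw0 t hta) (by
          rw [hwadd t b hta htb.le le_rfl]; linarith [hδ0 t b htb.le])) hη.le) hηρ)
      set c : ℝ → Fin k → ℝ := fun h i => ∫ s in t..h, u i s with hc
      have hle : 𝓝[>] t ≤ 𝓝[Icc t b] t := 
        nhdsWithin_le_of_mem (mem_of_superset (Ioc_mem_nhdsGT htb) Ioc_subset_Icc_self)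
      have hc0 : Tendsto c (𝓝[>] t) (𝓝 0) := by
        rw [tendsto_pi_nhds]
        intro i
        have := intervalIntegral.continuousOn_primitive_interval (a := t) (b := b) (f := u i)
          (μ := volume) (by
            rw [uIcc_of_le htb.le]; exact (hu i).mono_set (Icc_subset_Icc_left hta))
        rw [uIcc_of_le htb.le] at this
        have := this t (left_mem_Icc.2 htb.le)
        rw [ContinuousWithinAt, intervalIntegral.integral_same] at this
        exact this.mono_left hle
      have hcσ : Tendsto (fun h => (c h, σ)) (𝓝[>] t) (𝓝 (0, σ)) :=
        hc0.prodMk_nhds tendsto_const_nhds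
      have hXγ : ∀ᶠ h in 𝓝[>] t, ∀ s ∈ Icc t h, ∀ i, ‖X i (γ s) - X i (γ t)‖ ≤ η := by
        have e : ∀ᶠ s in 𝓝[Icc t b] t, ∀ i, ‖X i (γ s) - X i (γ t)‖ < η := by
          rw [eventually_all]
          intro i
          have hXc : ContinuousAt (X i) (γ t) :=
            (hX i).continuousOn.continuousAt (hU.mem_nhds (hγU t htI))
          have hγt : Tendsto γ (𝓝[Icc t b] t) (𝓝 (γ t)) :=
            (hγc t htI).mono_left (nhdsWithin_mono _ (Icc_subset_Icc_left hta))
          have := ((hXc.tendsto.comp hγt).sub_const (X i (γ t))).norm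
          rw [sub_self, norm_zero] at this
          exact this.eventually (Iio_mem_nhds hη)
        rw [eventually_nhdsWithin_iff, Metric.eventually_nhds_iff] at e
        obtain ⟨r, hr, he⟩ := e
        filter_upwards [Ioo_mem_nhdsGT (show t < min b (t + r) from lt_min htb (by linarith))]
          with h hh s hs i
        have h1 : h < b := hh.2.trans_le (min_le_left _ _)
        have h2 : h < t + r := hh.2.trans_le (min_le_right _ _)
        refine (he (y := s) ?_ ⟨hs.1, hs.2.trans h1.le⟩ i).le
        rw [Real.dist_eq, abs_lt]; constructor <;> linarith [hs.1, hs.2]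
      have hev := (hcσ.eventually (m1 η hη)).and ((hcσ.eventually m2).and
        (hXγ.and (Ioc_mem_nhdsGT (show t < min b y from lt_min htb hy) :
          ∀ᶠ h in 𝓝[>] t, h ∈ Ioc t (min b y))))
      obtain ⟨h, n1, n2, n3, n4⟩ := hev.exists
      have hth : t ≤ h := n4.1.le
      have hhb : h ≤ b := n4.2.trans (min_le_left _ _)
      have hah : a ≤ h := hta.trans hth
      have hhI : h ∈ Icc a b := ⟨hah, hhb⟩
      set δ := ∫ s in t..h, v s with hδ
      have hδn : 0 ≤ δ := hδ0 t h hth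
      have hcδ : ∑ i, |c h i| ≤ δ := by
        have : δ = ∑ i, ∫ s in t..h, |u i s| := by
          rw [hδ, hv]
          exact intervalIntegral.integral_finsetSum fun i _ => (sub (hu i) hta hth hhb).abs
        rw [this]
        exact Finset.sum_le_sum fun i _ => intervalIntegral.abs_integral_le_integral_abs hth
      have hγdiff : ‖γ h - γ t - ∑ i, c h i • X i (γ t)‖ ≤ η * δ := by
        have e1 : γ h - γ t = ∫ s in t..h, ∑ i, u i s • X i (γ s) := by
          rw [hγe h hhI, hγe t htI, add_sub_add_left_eq_sub]
          exact intervalIntegral.integral_interval_sub_left (sub hint le_rfl hah hhb)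
            (sub hint le_rfl hta htb.le)
        have e2 : ∑ i, c h i • X i (γ t) = ∫ s in t..h, ∑ i, u i s • X i (γ t) := by
          rw [intervalIntegral.integral_finsetSum
            fun i _ => sub ((hu i).smul_const (X i (γ t))) hta hth hhb]
          refine Finset.sum_congr rfl fun i _ => ?_
          rw [intervalIntegral.integral_smul_const]
        have i2 : IntervalIntegrable (fun s => ∑ i, u i s • X i (γ t)) volume t h := 
          sub (h := fun s => ∑ i, u i s • X i (γ t))
            (integrable_finsetSum _ fun i _ => (hu i).smul_const (X i (γ t))) hta hth hhb
        rw [e1, e2, ← intervalIntegral.integral_sub (sub hint hta hth hhb) i2, hδ,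
          ← intervalIntegral.integral_const_mul]
        refine intervalIntegral.norm_integral_le_of_norm_le hth ?_
          ((sub hvi hta hth hhb).const_mul η)
        refine Eventually.of_forall fun s hs => ?_
        rw [← Finset.sum_sub_distrib, hv, Finset.mul_sum]
        refine (norm_sum_le _ _).trans (Finset.sum_le_sum fun i _ => ?_)
        rw [← smul_sub, norm_smul, Real.norm_eq_abs, mul_comm]
        gcongr
        exact n3 s (Ioc_subset_Icc_self hs) i
      have hlipsum : ‖∑ i, c h i • X i σ - ∑ i, c h i • X i (γ t)‖ ≤ δ * (L * ‖σ - γ t‖) := by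
        rw [← Finset.sum_sub_distrib]
        calc _ ≤ ∑ i, |c h i| * (L * ‖σ - γ t‖) := by
              refine (norm_sum_le _ _).trans (Finset.sum_le_sum fun i _ => ?_)
              rw [← smul_sub, norm_smul, Real.norm_eq_abs]
              gcongr
              exact hLip i t htI σ hσρ
          _ = (∑ i, |c h i|) * (L * ‖σ - γ t‖) := by rw [Finset.sum_mul]
          _ ≤ _ := by gcongr
      have hnew : ‖Ψ (c h, σ) - γ h‖ ≤ η * B (w h) := by
        have e : Ψ (c h, σ) - γ h = (Ψ (c h, σ) - σ - ∑ i, c h i • X i σ)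
            - (γ h - γ t - ∑ i, c h i • X i (γ t)) + (σ - γ t)
            + (∑ i, c h i • X i σ - ∑ i, c h i • X i (γ t)) := by abel
        have t1 : ‖Ψ (c h, σ) - γ h‖ ≤ η * δ + η * δ + ‖σ - γ t‖ + δ * (L * ‖σ - γ t‖) := by
          rw [e]
          refine (norm_add_le _ _).trans (add_le_add ((norm_add_le _ _).trans
            (add_le_add ((norm_sub_le _ _).trans (add_le_add ?_ hγdiff)) le_rfl)) hlipsum)
          exact n1.trans (by gcongr)
        have t2 := hBstep (w t) δ (hw0 t hta) hδn
        rw [hwadd t h hta hth hhb]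
        calc _ ≤ _ := t1
          _ = ‖σ - γ t‖ * (1 + L * δ) + 2 * (η * δ) := by ring
          _ ≤ η * B (w t) * (1 + L * δ) + 2 * (η * δ) := by gcongr
          _ = η * (B (w t) * (1 + L * δ) + 2 * δ) := by ring
          _ ≤ _ := by gcongr
      have hwhb : w h ≤ w b := by rw [hwadd h b hah hhb le_rfl]; linarith [hδ0 h b hhb]
      refine ⟨h, ⟨hhI, Ψ (c h, σ), hmemK h hhI _ (hnew.trans (le_trans
        (mul_le_mul_of_nonneg_left (hBmono _ _ (hw0 h hah) hwhb) hη.le) hηρ)), hnew, ?_⟩,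
        n4.1, n4.2.trans (min_le_right _ _)⟩
      have := abs_add_le (f (Ψ (c h, σ)) - f σ) (f σ - f (γ a))
      rw [sub_add_sub_cancel] at this
      rw [hwadd t h hta hth hhb, mul_add]
      have : C * ∑ i, |c h i| ≤ C * δ := by gcongr
      linarith
    have := hSclosed.Icc_subset_of_forall_exists_gt hSa hstep (right_mem_Icc.2 hab)
    obtain ⟨-, σ, -, h1, h2⟩ := this
    exact ⟨σ, h1, h2⟩
  -- conclusion
  refine le_of_forall_pos_le_add fun e he => ?_
  have hfb : ContinuousAt f (γ b) :=
    hf.continuousAt (hU.mem_nhds (hγU b (right_mem_Icc.2 hab)))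
  obtain ⟨r, hr, hr'⟩ := Metric.continuousAt_iff.1 hfb e he
  have hBb : 0 ≤ B (w b) := hB0 _ (hw0 b hab)
  have hm : 0 < min ρ (r / 2) := lt_min hρ (half_pos hr)
  have hηB : min ρ (r / 2) / (B (w b) + 1) * B (w b) ≤ min ρ (r / 2) := by
    rw [div_mul_eq_mul_div, div_le_iff₀ (by positivity)]
    gcongr
    linarith
  obtain ⟨σ, s1, s2⟩ := main (min ρ (r / 2) / (B (w b) + 1)) (by positivity)
    (hηB.trans (min_le_left _ _))
  have s3 := hr' (x := σ) (by
    rw [dist_eq_norm]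
    exact lt_of_le_of_lt (s1.trans (hηB.trans (min_le_right _ _))) (half_lt_self hr))
  rw [Real.dist_eq] at s3
  have := abs_sub_le (f (γ b)) (f σ) (f (γ a))
  rw [abs_sub_comm (f (γ b)) (f σ)] at this
  linarith

end Lip

section Final
variable {n k : ℕ}

lemma cutoff_hder {U : Set (Fin n → ℝ)} {Y : (Fin n → ℝ) → (Fin n → ℝ)}
    {f g : (Fin n → ℝ) → ℝ} (h : HDer U Y f g) {χ : (Fin n → ℝ) → ℝ} (hχ : ContDiff ℝ 1 χ)
    (c : ℝ) :
    HDer U Y (fun x => χ x * (f x - c))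
      (fun x => fderiv ℝ χ x (Y x) * (f x - c) + χ x * g x) := by
  intro x hx
  obtain ⟨α, h0, h1, h2⟩ := h x hx
  refine ⟨α, h0, h1, ?_⟩
  have hα := h1.self_of_nhds.2
  have d1 : HasDerivAt (fun t => χ (α t)) (fderiv ℝ χ (α 0) (Y (α 0))) 0 :=
    ((hχ.differentiable one_ne_zero) (α 0)).hasFDerivAt.comp_hasDerivAt 0 hα
  have d2 := d1.mul (h2.sub_const c)
  rw [h0] at d2
  exact d2

lemma sum_abs_le_length {u : Fin k → ℝ → ℝ} {a b : ℝ} (hab : a ≤ b)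
    (hu : ∀ i, IntegrableOn (u i) (Icc a b)) :
    ∫ s in a..b, ∑ i, |u i s| ≤ k * srLength u a b := by
  have hle : ∀ s, ∑ i, |u i s| ≤ k * Real.sqrt (∑ i, (u i s) ^ 2) := by
    intro s
    calc ∑ i, |u i s| ≤ ∑ _i : Fin k, Real.sqrt (∑ i, (u i s) ^ 2) := by
          refine Finset.sum_le_sum fun i _ => ?_
          rw [← Real.sqrt_sq_eq_abs]
          exact Real.sqrt_le_sqrt (Finset.single_le_sum (f := fun i => (u i s) ^ 2)
            (fun i _ => sq_nonneg _) (Finset.mem_univ i))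
      _ = _ := by simp
  have hle' : ∀ s, Real.sqrt (∑ i, (u i s) ^ 2) ≤ ∑ i, |u i s| := by
    intro s
    rw [Real.sqrt_le_left (Finset.sum_nonneg fun i _ => abs_nonneg _)]
    calc ∑ i, (u i s) ^ 2 = ∑ i, |u i s| ^ 2 := by simp
      _ ≤ _ := Finset.sum_sq_le_sq_sum_of_nonneg fun i _ => abs_nonneg _
  have i1 : IntegrableOn (fun s => ∑ i, |u i s|) (Icc a b) :=
    integrable_finsetSum _ fun i _ => (hu i).abs
  have m : AEStronglyMeasurable (fun s => Real.sqrt (∑ i, (u i s) ^ 2))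
      (volume.restrict (Icc a b)) := by
    refine Real.continuous_sqrt.comp_aestronglyMeasurable ?_
    exact Finset.aestronglyMeasurable_fun_sum _ fun i _ => (hu i).aestronglyMeasurable.pow 2
  have i2 : IntegrableOn (fun s => Real.sqrt (∑ i, (u i s) ^ 2)) (Icc a b) := by
    refine Integrable.mono' i1 m (Eventually.of_forall fun s => ?_)
    rw [Real.norm_eq_abs, abs_of_nonneg (Real.sqrt_nonneg _)]
    exact hle' s
  rw [srLength, ← intervalIntegral.integral_const_mul]
  refine intervalIntegral.integral_mono_on hab ?_ ?_ fun s _ => hle s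
  · rwa [intervalIntegrable_iff_integrableOn_Icc_of_le hab]
  · exact ((intervalIntegrable_iff_integrableOn_Icc_of_le hab).2 i2).const_mul _

lemma final_lip {U : Set (Fin n → ℝ)} (hU : IsOpen U)
    {X : Fin k → (Fin n → ℝ) → (Fin n → ℝ)}
    (hX : ∀ i, ContDiffOn ℝ (⊤ : ℕ∞) (X i) U) (hbg : BracketGenerating U (Set.range X))
    {f : (Fin n → ℝ) → ℝ} {g : Fin k → (Fin n → ℝ) → ℝ} (hgC : ∀ i, ContinuousOn (g i) U)
    (hder : ∀ i, HDer U (X i) f (g i)) {x₀ : Fin n → ℝ} (hx₀ : x₀ ∈ U) :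
    ∃ (U' : Set (Fin n → ℝ)) (C : ℝ), U' ∈ nhds x₀ ∧ U' ⊆ U ∧
      ∀ x ∈ U', ENNReal.ofReal |f x - f x₀| ≤ ENNReal.ofReal C * srDist U X x x₀ := by
  have hf : ContinuousOn f U := fun x hx =>
    (f_continuousAt hU hX hbg hgC hder hx).continuousWithinAt
  obtain ⟨r, hr, hrU⟩ := Metric.nhds_basis_closedBall.mem_iff.1 (hU.mem_nhds hx₀)
  let χ : ContDiffBump x₀ := ⟨r / 2, r, half_pos hr, half_lt_self hr⟩
  have hχ : ContDiff ℝ 1 χ := χ.contDiff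
  set F : (Fin n → ℝ) → ℝ := fun x => χ x * (f x - f x₀) with hF
  set G : Fin k → (Fin n → ℝ) → ℝ :=
    fun i x => fderiv ℝ χ x (X i x) * (f x - f x₀) + χ x * g i x with hG
  have hFder : ∀ i, HDer U (X i) F (G i) := fun i => cutoff_hder (hder i) hχ _
  have hFc : ContinuousOn F U := χ.continuous.continuousOn.mul (hf.sub continuousOn_const)
  have hGc : ∀ i, ContinuousOn (G i) U := fun i =>
    (((hχ.continuous_fderiv one_ne_zero).continuousOn.clm_apply (hX i).continuousOn).mul
      (hf.sub continuousOn_const)).add (χ.continuous.continuousOn.mul (hgC i))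
  have hG0 : ∀ i x, x ∉ Metric.closedBall x₀ r → G i x = 0 := by
    intro i x hx
    have h1 : (χ : (Fin n → ℝ) → ℝ) =ᶠ[𝓝 x] fun _ => 0 := by
      filter_upwards [Metric.isClosed_closedBall.isOpen_compl.mem_nhds hx] with y hy
      apply χ.zero_of_le_dist
      rw [mem_compl_iff, Metric.mem_closedBall, not_le] at hy
      exact hy.le
    have h2 : fderiv ℝ χ x = 0 := by rw [h1.fderiv_eq]; simp
    simp [hG, h2, h1.self_of_nhds]
  have hbd : ∀ i, ∃ L : ℝ, ∀ x ∈ Metric.closedBall x₀ r, ‖G i x‖ ≤ L := fun i =>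
    (isCompact_closedBall x₀ r).exists_bound_of_continuousOn ((hGc i).mono hrU)
  choose L hL using hbd
  set C : ℝ := ∑ i, |L i| + 1 with hCdef
  have hS0 : 0 ≤ ∑ i, |L i| := Finset.sum_nonneg fun i _ => abs_nonneg _
  have hCpos : 0 < C := by linarith
  have hC : ∀ i, ∀ x ∈ U, |G i x| < C := by
    intro i x _
    by_cases hx : x ∈ Metric.closedBall x₀ r
    · have a1 := hL i x hx
      have a2 := Finset.single_le_sum (f := fun i => |L i|) (fun i _ => abs_nonneg _)
        (Finset.mem_univ i)
      rw [Real.norm_eq_abs] at a1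
      have a3 := le_abs_self (L i)
      linarith
    · rw [hG0 i x hx, abs_zero]; exact hCpos
  have hlen : ∀ x, ∀ ℓ ∈ HorizontalLengths U X x x₀, 0 ≤ ℓ ∧ |F x - F x₀| ≤ C * k * ℓ := by
    rintro x ℓ ⟨N, t, γ, u, hmono, rfl, hlast, hctl, rfl⟩
    have hstep : ∀ j : Fin N, |F (γ (t j.succ)) - F (γ (t j.castSucc))| ≤
        C * k * srLength (u j) (t j.castSucc) (t j.succ) := by
      intro j
      have h1 := controlled_lip hU hX hFc hGc hFder hCpos.le hC (hctl j)
      have h2 := sum_abs_le_length (hctl j).1 (hctl j).2.2.2.1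
      rw [mul_assoc]
      exact h1.trans (mul_le_mul_of_nonneg_left h2 hCpos.le)
    refine ⟨Finset.sum_nonneg fun j _ => intervalIntegral.integral_nonneg (hctl j).1
      fun s _ => Real.sqrt_nonneg _, ?_⟩
    have htel : F x₀ - F (γ (t 0)) =
        ∑ j : Fin N, (F (γ (t j.succ)) - F (γ (t j.castSucc))) := by
      rw [← hlast, Finset.sum_sub_distrib]
      have e1 := Fin.sum_univ_succ fun j => F (γ (t j))
      have e2 := Fin.sum_univ_castSucc fun j => F (γ (t j))
      linarith
    rw [abs_sub_comm, htel, Finset.mul_sum]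
    exact (Finset.abs_sum_le_sum_abs _ _).trans (Finset.sum_le_sum fun j _ => hstep j)
  refine ⟨Metric.closedBall x₀ (r / 2), C * k + 1, Metric.closedBall_mem_nhds _ (half_pos hr),
    (Metric.closedBall_subset_closedBall (half_le_self hr.le)).trans hrU, fun x hx => ?_⟩
  have hFx : F x - F x₀ = f x - f x₀ := by
    have : χ x = 1 := χ.one_of_mem_closedBall hx
    simp [hF, this]
  have hC'pos : 0 < C * k + 1 := by positivity
  rw [← hFx, mul_comm, ← ENNReal.div_le_iff (by simpa using hC'pos) ENNReal.ofReal_ne_top]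
  refine le_sInf ?_
  rintro _ ⟨ℓ, hℓ, rfl⟩
  rw [ENNReal.div_le_iff (by simpa using hC'pos) ENNReal.ofReal_ne_top]
  obtain ⟨h0, h1⟩ := hlen x ℓ hℓ
  rw [← ENNReal.ofReal_mul h0]
  refine ENNReal.ofReal_le_ofReal ?_
  nlinarith

end Final

end HelperMaterial

/-- If all horizontal derivatives `Xᵢ f` exist and are continuous on `U`, where the smooth
vector fields `X₁, …, X_k` are bracket generating and pointwise linearly independent on the
open set `U ⊆ ℝⁿ`, then around every `x₀ ∈ U` the function `f` is Lipschitz with respect to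
the subriemannian distance: `|f(x) − f(x₀)| ≤ C·d(x,x₀)` near `x₀`. -/
theorem sub_lipschitz_of_horizontal_derivatives {n k : ℕ} (U : Set (Fin n → ℝ))
    (hUopen : IsOpen U) (X : Fin k → (Fin n → ℝ) → (Fin n → ℝ))
    (hXsmooth : ∀ i, ContDiffOn ℝ (⊤ : ℕ∞) (X i) U)
    (hli : ∀ x ∈ U, LinearIndependent ℝ fun i => X i x)
    (hbg : BracketGenerating U (Set.range X))
    (f : (Fin n → ℝ) → ℝ) (g : Fin k → (Fin n → ℝ) → ℝ)
    (hgC : ∀ i, ContinuousOn (g i) U)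
    (hder : ∀ i, ∀ x ∈ U, ∃ α : ℝ → Fin n → ℝ, α 0 = x ∧
      (∀ᶠ t in nhds (0 : ℝ), α t ∈ U ∧ HasDerivAt α (X i (α t)) t) ∧
      HasDerivAt (fun t => f (α t)) (g i x) 0)
    (x₀ : Fin n → ℝ) (hx₀ : x₀ ∈ U) :
    ∃ (U' : Set (Fin n → ℝ)) (C : ℝ), U' ∈ nhds x₀ ∧ U' ⊆ U ∧
      ∀ x ∈ U', ENNReal.ofReal |f x - f x₀| ≤ ENNReal.ofReal C * srDist U X x x₀ := by
  exact final_lip hUopen hXsmooth hbg hgC hder hx₀
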